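/- Let (X, μ) be an ergodic probability-measure-preserving ℤ^r-space, B a measurable set with μ(B) > 0, and σ_B the spectral measure of B. Suppose σ_B(Rat ℤ^r \ {0}) < ε·μ(B)². Then for any haystack H ⊆ ℤ^r there exists λ ∈ H such that μ(⋃_{m∈ℤ} (mλ).B) > 1 − ε. -/

import Mathlib

open MeasureTheory

/-- The pairing `⟨ξ, v⟩ ∈ ℂ` between a character `ξ ∈ 𝕋^r ≅ \widehat{ℤ^r}` and `v ∈ ℤ^r`. -/
noncomputable def charPair {r : ℕ} (ξ : Fin r → AddCircle (1 : ℝ)) (v : Fin r → ℤ) : ℂ :=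
  ∏ i, (AddCircle.toCircle ((v i) • ξ i) : ℂ)

/-- The rational spectrum `Rat ℤ^r ⊆ \widehat{ℤ^r} ≅ 𝕋^r`: characters whose kernel has
finite index in `ℤ^r`, equivalently the torsion points of `𝕋^r`. -/
def ratSpectrum (r : ℕ) : Set (Fin r → AddCircle (1 : ℝ)) :=
  {ξ | ∀ i, IsOfFinAddOrder (ξ i)}

/-- A haystack in `ℤ^r`: an infinite set any `r` of whose elements are linearly
independent over `ℝ`. -/
def IsHaystack {r : ℕ} (H : Set (Fin r → ℤ)) : Prop :=
  H.Infinite ∧ ∀ v : Fin r → (Fin r → ℤ), (∀ k, v k ∈ H) → Function.Injective v →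
    LinearIndependent ℝ (fun k => (fun i => (v k i : ℝ)))

open Filter Topology Complex

section CharPair

variable {r : ℕ}

lemma charPair_eq_toCircle_sum (ξ : Fin r → AddCircle (1 : ℝ)) (v : Fin r → ℤ) :
    charPair ξ v = (AddCircle.toCircle (∑ i, v i • ξ i) : ℂ) := by
  have h : ∀ s : Finset (Fin r),
      ∏ i ∈ s, (AddCircle.toCircle (v i • ξ i) : ℂ) =
        (AddCircle.toCircle (∑ i ∈ s, v i • ξ i) : ℂ) := by
    intro s
    induction s using Finset.cons_induction with
    | empty => simp
    | cons a s ha ih => rw [Finset.prod_cons, Finset.sum_cons, AddCircle.toCircle_add, ih]; simp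
  exact h Finset.univ

lemma norm_charPair (ξ : Fin r → AddCircle (1 : ℝ)) (v : Fin r → ℤ) : ‖charPair ξ v‖ = 1 := by
  rw [charPair_eq_toCircle_sum, Circle.norm_coe]

lemma charPair_zero_left (v : Fin r → ℤ) : charPair (0 : Fin r → AddCircle (1 : ℝ)) v = 1 := by
  simp [charPair]

lemma charPair_eq_one_iff {ξ : Fin r → AddCircle (1 : ℝ)} {v : Fin r → ℤ} :
    charPair ξ v = 1 ↔ ∑ i, v i • ξ i = 0 := by
  rw [charPair_eq_toCircle_sum, ← Circle.coe_one, Circle.coe_inj,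
    ← AddCircle.toCircle_zero (T := (1 : ℝ)),
    (AddCircle.injective_toCircle one_ne_zero).eq_iff]

lemma charPair_nsmul (ξ : Fin r → AddCircle (1 : ℝ)) (n : ℕ) (v : Fin r → ℤ) :
    charPair ξ (n • v) = charPair ξ v ^ n := by
  rw [charPair_eq_toCircle_sum, charPair_eq_toCircle_sum, ← Circle.coe_pow,
    ← AddCircle.toCircle_nsmul, Finset.smul_sum]
  simp [mul_smul]

lemma charPair_sub (ξ : Fin r → AddCircle (1 : ℝ)) (v w : Fin r → ℤ) :
    charPair ξ (v - w) = charPair ξ v * (starRingEnd ℂ) (charPair ξ w) := by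
  have h : ∑ i, (v - w) i • ξ i = ∑ i, v i • ξ i + -∑ i, w i • ξ i := by
    rw [← sub_eq_add_neg, ← Finset.sum_sub_distrib]
    exact Finset.sum_congr rfl fun i _ => sub_smul _ _ _
  simp only [charPair_eq_toCircle_sum]
  rw [h, AddCircle.toCircle_add, AddCircle.toCircle_neg, Circle.coe_mul, Circle.coe_inv_eq_conj]

lemma continuous_charPair (v : Fin r → ℤ) :
    Continuous fun ξ : Fin r → AddCircle (1 : ℝ) => charPair ξ v := by
  unfold charPair
  refine continuous_finsetProd _ fun i _ => ?_
  exact continuous_subtype_val.comp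
    (AddCircle.continuous_toCircle.comp ((continuous_zsmul (v i)).comp (continuous_apply i)))

lemma measurableSet_charPair_eq_one (v : Fin r → ℤ) :
    MeasurableSet {ξ : Fin r → AddCircle (1 : ℝ) | charPair ξ v = 1} :=
  (isClosed_singleton.preimage (continuous_charPair v)).measurableSet

lemma measurableSet_ratSpectrum : MeasurableSet (ratSpectrum r) := by
  have h : ratSpectrum r =
      ⋂ i : Fin r, ⋃ n : {n : ℕ // 0 < n}, {ξ | n.1 • ξ i = (0 : AddCircle (1 : ℝ))} := by
    ext ξ
    simp [ratSpectrum, isOfFinAddOrder_iff_nsmul_eq_zero]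
  rw [h]
  refine MeasurableSet.iInter fun i => MeasurableSet.iUnion fun n => ?_
  exact (isClosed_eq ((continuous_nsmul n.1).comp (continuous_apply i))
    continuous_const).measurableSet

/-- A character that is trivial on `r` linearly independent vectors is rational. -/
lemma mem_ratSpectrum_of_linearIndependent {ξ : Fin r → AddCircle (1 : ℝ)}
    {v : Fin r → Fin r → ℤ} (hv : LinearIndependent ℝ fun k i => (v k i : ℝ))
    (hξ : ∀ k, charPair ξ (v k) = 1) : ξ ∈ ratSpectrum r := by
  let M : Matrix (Fin r) (Fin r) ℤ := Matrix.of v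
  have hdet : M.det ≠ 0 := by
    intro h0
    have hu : IsUnit (M.map (Int.castRingHom ℝ)) :=
      Matrix.linearIndependent_rows_iff_isUnit.mp hv
    rw [Matrix.isUnit_iff_isUnit_det, ← RingHom.mapMatrix_apply, ← RingHom.map_det, h0] at hu
    simp at hu
  intro j
  refine isOfFinAddOrder_iff_zsmul_eq_zero.mpr ⟨M.det, hdet, ?_⟩
  calc M.det • ξ j = ∑ i, (M.adjugate * M) j i • ξ i := by
        rw [Matrix.adjugate_mul]
        simp [Matrix.smul_apply, Matrix.one_apply, ite_smul]
    _ = ∑ k, M.adjugate j k • ∑ i, v k i • ξ i := by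
        simp only [Matrix.mul_apply, Finset.sum_smul, Finset.smul_sum, mul_smul]
        rw [Finset.sum_comm]
        rfl
    _ = 0 := by simp [fun k => charPair_eq_one_iff.mp (hξ k)]

/-- An irrational character is trivial on fewer than `r` elements of a haystack. -/
lemma IsHaystack.card_filter_charPair_lt {H : Set (Fin r → ℤ)} (hH : IsHaystack H)
    {F : Finset (Fin r → ℤ)} (hF : ↑F ⊆ H) {ξ : Fin r → AddCircle (1 : ℝ)}
    (hξ : ξ ∉ ratSpectrum r) : (F.filter fun v => charPair ξ v = 1).card < r := by
  by_contra! hcard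
  obtain ⟨G, hGF, hG⟩ := Finset.exists_subset_card_eq hcard
  let e := G.equivFinOfCardEq hG
  have hmem : ∀ k, (e.symm k : Fin r → ℤ) ∈ F ∧ charPair ξ (e.symm k) = 1 := fun k =>
    Finset.mem_filter.mp (hGF (e.symm k).2)
  exact hξ (mem_ratSpectrum_of_linearIndependent
    (hH.2 (fun k => e.symm k) (fun k => hF (hmem k).1)
      (Subtype.val_injective.comp e.symm.injective)) fun k => (hmem k).2)

/-- Some element of a haystack is annihilated by only a small set of irrational characters. -/
lemma IsHaystack.exists_measureReal_lt {H : Set (Fin r → ℤ)} (hH : IsHaystack H)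
    (σ : Measure (Fin r → AddCircle (1 : ℝ))) [IsFiniteMeasure σ] {δ : ℝ} (hδ : 0 < δ) :
    ∃ v ∈ H, σ.real ({ξ | charPair ξ v = 1} \ ratSpectrum r) < δ := by
  classical
  by_contra! hcon
  obtain ⟨n, hn⟩ := exists_nat_gt (r * σ.real Set.univ / δ)
  obtain ⟨F, hF, hFn⟩ := hH.1.exists_subset_card_eq n
  have hmeas : ∀ v : Fin r → ℤ, MeasurableSet
      ({ξ : Fin r → AddCircle (1 : ℝ) | charPair ξ v = 1} \ ratSpectrum r) := fun v =>
    (measurableSet_charPair_eq_one v).diff measurableSet_ratSpectrum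
  have hle : ∑ v ∈ F, σ.real ({ξ | charPair ξ v = 1} \ ratSpectrum r) ≤ r * σ.real Set.univ := by
    have hint : ∀ v ∈ F, Integrable
        (({ξ | charPair ξ v = 1} \ ratSpectrum r).indicator (1 : (Fin r → AddCircle (1 : ℝ)) → ℝ)) σ := fun v _ =>
      (integrable_const (1 : ℝ)).indicator (hmeas v)
    calc ∑ v ∈ F, σ.real ({ξ | charPair ξ v = 1} \ ratSpectrum r)
        = ∫ ξ, ∑ v ∈ F, ({ξ | charPair ξ v = 1} \ ratSpectrum r).indicator 1 ξ ∂σ := by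
          rw [integral_finsetSum _ hint]
          exact Finset.sum_congr rfl fun v _ => (integral_indicator_one (hmeas v)).symm
      _ ≤ ∫ _, (r : ℝ) ∂σ := by
          refine integral_mono (integrable_finsetSum _ hint) (integrable_const _) fun ξ => ?_
          by_cases hξ : ξ ∈ ratSpectrum r
          · simp [Set.indicator, hξ]
          · have := (hH.card_filter_charPair_lt hF hξ).le
            simpa [Set.indicator, hξ] using this
      _ = r * σ.real Set.univ := by simp [mul_comm]
  have hge : n * δ ≤ ∑ v ∈ F, σ.real ({ξ | charPair ξ v = 1} \ ratSpectrum r) := by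
    rw [← hFn, ← nsmul_eq_mul]
    exact Finset.card_nsmul_le_sum _ _ _ fun v hv => hcon v (hF hv)
  rw [div_lt_iff₀ hδ] at hn
  linarith

/-- The mean-square of the averages of a character over `0, v, 2v, …` tends to the mass of the
annihilator of `v`. -/
lemma tendsto_integral_norm_average_charPair_sq (σ : Measure (Fin r → AddCircle (1 : ℝ)))
    [IsFiniteMeasure σ] (v : Fin r → ℤ) :
    Tendsto (fun N : ℕ => ∫ ξ, ‖∑ n ∈ Finset.range N,
      ((N : ℝ)⁻¹ : ℂ) * charPair ξ (n • v)‖ ^ 2 ∂σ) atTop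
      (𝓝 (σ.real {ξ | charPair ξ v = 1})) := by
  rw [← integral_indicator_one (measurableSet_charPair_eq_one v)]
  refine tendsto_integral_of_dominated_convergence (fun _ => 1) (fun N => ?_)
    (integrable_const _) (fun N => ae_of_all _ fun ξ => ?_) (ae_of_all _ fun ξ => ?_)
  · refine Continuous.aestronglyMeasurable ?_
    exact (continuous_finsetSum _ fun n _ =>
      continuous_const.mul (continuous_charPair _)).norm.pow 2
  · rw [norm_pow, norm_norm]
    refine pow_le_one₀ (norm_nonneg _) ((norm_sum_le _ _).trans ?_)
    simp only [norm_mul, norm_charPair, mul_one, Finset.sum_const, Finset.card_range]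
    rcases eq_or_ne N 0 with rfl | hN
    · simp
    · simp [hN]
  · by_cases h1 : charPair ξ v = 1
    · simp only [charPair_nsmul, h1]
      refine tendsto_const_nhds.congr' ?_
      filter_upwards [eventually_ne_atTop 0] with N hN
      simp [Set.indicator, h1, hN]
    · have hpos : 0 < ‖charPair ξ v - 1‖ := norm_pos_iff.mpr (sub_ne_zero.mpr h1)
      have hbound : ∀ N : ℕ, ‖∑ n ∈ Finset.range N, ((N : ℝ)⁻¹ : ℂ) * charPair ξ (n • v)‖ ≤
          (N : ℝ)⁻¹ * (2 / ‖charPair ξ v - 1‖) := by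
        intro N
        rw [← Finset.mul_sum]
        simp only [charPair_nsmul]
        rw [geom_sum_eq h1, norm_mul, norm_div]
        have h2 : ‖charPair ξ v ^ N - 1‖ ≤ 2 := by
          refine (norm_sub_le _ _).trans ?_
          rw [norm_pow, norm_charPair]
          norm_num
        simp only [norm_inv, norm_real, Real.norm_natCast]
        gcongr
      have hlim : Tendsto (fun N : ℕ => (N : ℝ)⁻¹ * (2 / ‖charPair ξ v - 1‖)) atTop (𝓝 0) := by
        simpa using tendsto_inv_atTop_nhds_zero_nat.mul_const (2 / ‖charPair ξ v - 1‖)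
      have := (squeeze_zero (fun _ => norm_nonneg _) hbound hlim).pow 2
      simpa [Set.indicator, h1] using this

end CharPair

section Hilbert

variable {E : Type*} [NormedAddCommGroup E] [InnerProductSpace ℝ E] {r : ℕ}

/-- The norm of a combination of vectors whose Gram matrix is given by the Fourier coefficients
of `σ` is the `L²(σ)` norm of the corresponding trigonometric polynomial. -/
lemma norm_sum_sq_eq_integral_charPair {σ : Measure (Fin r → AddCircle (1 : ℝ))}
    [IsFiniteMeasure σ] {e : (Fin r → ℤ) → E}
    (he : ∀ v w, ((inner ℝ (e v) (e w) : ℝ) : ℂ) = ∫ ξ, charPair ξ (w - v) ∂σ)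
    {ι : Type*} (s : Finset ι) (d : ι → ℝ) (v : ι → Fin r → ℤ) :
    ‖∑ i ∈ s, d i • e (v i)‖ ^ 2 = ∫ ξ, ‖∑ i ∈ s, (d i : ℂ) * charPair ξ (v i)‖ ^ 2 ∂σ := by
  have hint : ∀ u : Fin r → ℤ, Integrable (fun ξ => charPair ξ u) σ := fun u =>
    (integrable_const (1 : ℝ)).mono' (continuous_charPair u).aestronglyMeasurable
      (ae_of_all _ fun ξ => (norm_charPair ξ u).le)
  rw [← ofReal_inj, ← integral_complex_ofReal, ← real_inner_self_eq_norm_sq]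
  have hexp : ∀ ξ : Fin r → AddCircle (1 : ℝ),
      ((‖∑ i ∈ s, (d i : ℂ) * charPair ξ (v i)‖ ^ 2 : ℝ) : ℂ) =
        ∑ i ∈ s, ∑ j ∈ s, (d i : ℂ) * d j * charPair ξ (v j - v i) := by
    intro ξ
    rw [ofReal_pow, ← conj_mul', map_sum, Finset.sum_mul_sum]
    refine Finset.sum_congr rfl fun i _ => Finset.sum_congr rfl fun j _ => ?_
    rw [charPair_sub, map_mul, conj_ofReal]
    ring
  simp only [hexp]
  rw [integral_finsetSum _ fun i _ => integrable_finsetSum _ fun j _ => (hint _).const_mul _,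
    sum_inner, ofReal_sum]
  refine Finset.sum_congr rfl fun i _ => ?_
  rw [integral_finsetSum _ fun j _ => (hint _).const_mul _, inner_sum, ofReal_sum]
  refine Finset.sum_congr rfl fun j _ => ?_
  rw [integral_const_mul, ← he, real_inner_smul_left, real_inner_smul_right]
  push_cast
  ring

/-- If every vector fixed by the isometries `U v` is a multiple of the unit vector `u`, the
spectral measure of an orbit has mass at most `b ^ 2` at the trivial character, where `b` is the
component of the orbit along `u`. -/
lemma measureReal_zero_le_inner_sq [CompleteSpace E] {σ : Measure (Fin r → AddCircle (1 : ℝ))}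
    [IsFiniteMeasure σ] {e : (Fin r → ℤ) → E}
    (he : ∀ v w, ((inner ℝ (e v) (e w) : ℝ) : ℂ) = ∫ ξ, charPair ξ (w - v) ∂σ)
    (U : (Fin r → ℤ) → E →ₗᵢ[ℝ] E) (hU : ∀ v w, U v (e w) = e (w + v))
    {u : E} (hu : ‖u‖ = 1) (hfix : ∀ g, (∀ v, U v g = g) → ∃ c : ℝ, g = c • u)
    {b : ℝ} (hb : ∀ v, inner ℝ u (e v) = b) : σ.real {0} ≤ b ^ 2 := by
  set K : Set E := closure (convexHull ℝ (Set.range e)) with hK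
  have hconv : Convex ℝ K := (convex_convexHull ℝ _).closure
  have hKU : ∀ v, ∀ x ∈ K, U v x ∈ K := by
    intro v
    refine Set.MapsTo.closure (fun x hx => ?_) (U v).continuous
    have : U v x ∈ (U v).toLinearMap '' convexHull ℝ (Set.range e) := ⟨x, hx, rfl⟩
    rw [LinearMap.image_convexHull] at this
    refine convexHull_mono ?_ this
    rintro _ ⟨_, ⟨w, rfl⟩, rfl⟩
    exact ⟨w + v, (hU v w).symm⟩
  have hbound : ∀ x ∈ K, σ.real {0} ≤ ‖x‖ ^ 2 := by
    intro x hx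
    refine closure_minimal (s := convexHull ℝ (Set.range e)) (t := {x | σ.real {0} ≤ ‖x‖ ^ 2})
      (fun y hy => ?_) (isClosed_le continuous_const (continuous_norm.pow 2)) hx
    rw [convexHull_eq] at hy
    obtain ⟨ι, t, d, z, -, hd1, hz, rfl⟩ := hy
    rw [Finset.centerMass_eq_of_sum_1 _ _ hd1]
    choose! v hv using hz
    have hsum : ∑ i ∈ t, d i • z i = ∑ i ∈ t, d i • e (v i) :=
      Finset.sum_congr rfl fun i hi => by rw [hv i hi]
    rw [Set.mem_ofPred_eq, hsum, norm_sum_sq_eq_integral_charPair he, ← integral_indicator_one (measurableSet_singleton 0)]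
    refine integral_mono ((integrable_const (1 : ℝ)).indicator (measurableSet_singleton 0))
      ?_ fun ξ => ?_
    · refine (integrable_const ((∑ i ∈ t, |d i|) ^ 2)).mono'
        (Continuous.aestronglyMeasurable <| (continuous_finsetSum _ fun n _ =>
          continuous_const.mul (continuous_charPair _)).norm.pow 2) (ae_of_all _ fun ξ => ?_)
      rw [norm_pow, norm_norm]
      gcongr
      refine (norm_sum_le _ _).trans_eq ?_
      simp [norm_charPair]
    · by_cases hξ : ξ = 0
      · subst hξ
        simp [charPair_zero_left, ← ofReal_sum, hd1]
      · simp [hξ]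
  have hinner : ∀ x ∈ K, inner ℝ u x = b := by
    intro x hx
    refine closure_minimal (s := convexHull ℝ (Set.range e)) (t := {x | inner ℝ u x = b})
      ?_ (isClosed_eq (by fun_prop) continuous_const) hx
    refine convexHull_min ?_ (convex_hyperplane (innerSL ℝ u).isBoundedLinearMap.toIsLinearMap b)
    rintro _ ⟨v, rfl⟩
    exact hb v
  have hne : K.Nonempty := ⟨e 0, subset_closure (subset_convexHull ℝ _ ⟨0, rfl⟩)⟩
  obtain ⟨g, hgK, hg⟩ := exists_norm_eq_iInf_of_complete_convex hne isClosed_closure.isComplete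
    hconv 0
  rw [norm_eq_iInf_iff_real_inner_le_zero hconv hgK] at hg
  have hgU : ∀ v, U v g = g := by
    intro v
    have h1 := hg _ (hKU v g hgK)
    have h2 := norm_sub_sq_real (U v g) g
    rw [zero_sub, inner_neg_left, inner_sub_right, real_inner_self_eq_norm_sq,
      real_inner_comm] at h1
    rw [LinearIsometry.norm_map] at h2
    have h3 : ‖U v g - g‖ ^ 2 ≤ 0 := by linarith
    exact sub_eq_zero.mp (norm_eq_zero.mp (pow_eq_zero_iff two_ne_zero |>.mp
      (le_antisymm h3 (sq_nonneg _))))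
  obtain ⟨c, rfl⟩ := hfix g hgU
  have hc := hinner _ hgK
  have := hbound _ hgK
  rw [real_inner_smul_right, real_inner_self_eq_norm_sq, hu] at hc
  rw [norm_smul, hu, mul_one, Real.norm_eq_abs, sq_abs] at this
  rwa [← hc, one_pow, mul_one]

end Hilbert

lemma image_eq_preimage_neg {r : ℕ} {X : Type*} {T : (Fin r → ℤ) → X → X}
    (hzero : ∀ x, T 0 x = x)
    (hadd : ∀ v w x, T (v + w) x = T v (T w x)) (v : Fin r → ℤ) (B : Set X) :
    T v '' B = T (-v) ⁻¹' B :=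
  congr_fun (Set.image_eq_preimage_of_inverse (fun x => by rw [← hadd, neg_add_cancel, hzero])
    fun x => by rw [← hadd, add_neg_cancel, hzero]) B

section Ergodic

variable {r : ℕ} {X : Type*} [MeasurableSpace X] {μ : Measure X} [IsProbabilityMeasure μ]
  {T : (Fin r → ℤ) → X → X}

/-- For an ergodic action of `ℤ^r`, an almost everywhere invariant function is constant. -/
lemma ae_eq_const_of_forall_comp_ae_eq (hmp : ∀ v, MeasurePreserving (T v) μ μ)
    (hadd : ∀ v w x, T (v + w) x = T v (T w x))
    (herg : ∀ A : Set X, MeasurableSet A → (∀ v, T v ⁻¹' A = A) → μ A = 0 ∨ μ A = 1)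
    {g : X → ℝ} (hgm : Measurable g) (hg : ∀ v, g ∘ T v =ᵐ[μ] g) :
    ∃ c : ℝ, g =ᵐ[μ] fun _ => c := by
  refine exists_eventuallyEq_const_of_forall_separating MeasurableSet fun S hS => ?_
  set A : Set X := ⋂ v, T v ⁻¹' (g ⁻¹' S) with hA
  have hAm : MeasurableSet A := .iInter fun v => (hmp v).measurable (hgm hS)
  have hAinv : ∀ v, T v ⁻¹' A = A := by
    intro v
    ext x
    simp only [hA, Set.mem_preimage, Set.mem_iInter, ← hadd]
    exact ⟨fun h w => by simpa using h (w - v), fun h w => h (w + v)⟩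
  have hAg : ∀ᵐ x ∂μ, x ∈ A ↔ g x ∈ S := by
    filter_upwards [ae_all_iff.mpr hg] with x hx
    simp only [hA, Set.mem_preimage, Set.mem_iInter]
    simp only [Function.comp_apply] at hx
    simp [hx]
  rcases herg A hAm hAinv with h | h
  · right
    filter_upwards [hAg, measure_eq_zero_iff_ae_notMem.mp h] with x hx hxA
    exact fun hxS => hxA (hx.mpr hxS)
  · left
    filter_upwards [hAg, (mem_ae_iff_prob_eq_one hAm).mpr h] with x hx hxA
    exact hx.mp hxA

/-- The translates of the indicator of `B`, as vectors in `L²(μ)`. -/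
noncomputable def translateIndicator (hmp : ∀ v, MeasurePreserving (T v) μ μ) {B : Set X}
    (hB : MeasurableSet B) (v : Fin r → ℤ) : Lp ℝ 2 μ :=
  indicatorConstLp 2 ((hmp v).measurable hB) (measure_ne_top μ _) 1

lemma inner_translateIndicator (hmp : ∀ v, MeasurePreserving (T v) μ μ)
    (hzero : ∀ x, T 0 x = x) (hadd : ∀ v w x, T (v + w) x = T v (T w x)) {B : Set X}
    (hB : MeasurableSet B) (v w : Fin r → ℤ) :
    inner ℝ (translateIndicator hmp hB v) (translateIndicator hmp hB w) =
      (μ (B ∩ T (w - v) '' B)).toReal := by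
  have h : T v ⁻¹' B ∩ T w ⁻¹' B = T w ⁻¹' (B ∩ T (w - v) '' B) := by
    rw [image_eq_preimage_neg hzero hadd]
    ext x
    simp [← hadd, and_comm]
  rw [translateIndicator, translateIndicator, L2.inner_indicatorConstLp_indicatorConstLp, h,
    measureReal_def, (hmp w).measure_preimage]
  · simp
  · rw [image_eq_preimage_neg hzero hadd]
    exact (hB.inter ((hmp _).measurable hB)).nullMeasurableSet

variable {B : Set X} {σB : Measure (Fin r → AddCircle (1 : ℝ))} [IsFiniteMeasure σB]

/-- For an ergodic action, the spectral measure of `B` has mass at most `μ(B) ^ 2` at the trivial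
character. -/
lemma spectralMeasure_zero_le (hmp : ∀ v, MeasurePreserving (T v) μ μ)
    (hzero : ∀ x, T 0 x = x) (hadd : ∀ v w x, T (v + w) x = T v (T w x))
    (herg : ∀ A : Set X, MeasurableSet A → (∀ v, T v ⁻¹' A = A) → μ A = 0 ∨ μ A = 1)
    (hB : MeasurableSet B)
    (hσ : ∀ v : Fin r → ℤ, ((μ (B ∩ T v '' B)).toReal : ℂ) = ∫ ξ, charPair ξ v ∂σB) :
    σB.real {0} ≤ μ.real B ^ 2 := by
  refine measureReal_zero_le_inner_sq (E := Lp ℝ 2 μ) (e := translateIndicator hmp hB)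
    (fun v w => by rw [inner_translateIndicator hmp hzero hadd, hσ])
    (fun v => Lp.compMeasurePreservingₗᵢ ℝ (T v) (hmp v)) (fun v w => ?_)
    (u := indicatorConstLp 2 MeasurableSet.univ (measure_ne_top μ _) 1) ?_ (fun g hg => ?_)
    fun v => ?_
  · change Lp.compMeasurePreserving (T v) (hmp v) _ = _
    rw [translateIndicator, translateIndicator, Lp.indicatorConstLp_compMeasurePreserving]
    congr 1
    ext x
    simp [hadd]
  · rw [norm_indicatorConstLp two_ne_zero ENNReal.ofNat_ne_top]
    simp
  · obtain ⟨c, hc⟩ := ae_eq_const_of_forall_comp_ae_eq hmp hadd herg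
      (Lp.stronglyMeasurable g).measurable fun v => by
        have h1 := Lp.coeFn_compMeasurePreserving g (hmp v)
        have h2 : Lp.compMeasurePreserving (T v) (hmp v) g = g := hg v
        rw [h2] at h1
        exact h1.symm
    refine ⟨c, Lp.ext ?_⟩
    filter_upwards [hc, Lp.coeFn_smul c (indicatorConstLp 2 MeasurableSet.univ
      (measure_ne_top μ _) (1 : ℝ)), indicatorConstLp_coeFn (p := 2) (μ := μ)
      (hs := MeasurableSet.univ) (hμs := measure_ne_top μ _) (c := (1 : ℝ))] with x h1 h2 h3
    rw [h1, h2, Pi.smul_apply, h3]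
    simp
  · rw [translateIndicator, L2.inner_indicatorConstLp_indicatorConstLp, Set.univ_inter,
      measureReal_def, (hmp v).measure_preimage hB.nullMeasurableSet]
    simp [measureReal_def]

/-- The saturation of `B` under `v` is large if the annihilator of `v` has small spectral
measure. -/
lemma measureReal_sq_le_mul_iUnion (hmp : ∀ v, MeasurePreserving (T v) μ μ)
    (hzero : ∀ x, T 0 x = x) (hadd : ∀ v w x, T (v + w) x = T v (T w x))
    (hB : MeasurableSet B)
    (hσ : ∀ v : Fin r → ℤ, ((μ (B ∩ T v '' B)).toReal : ℂ) = ∫ ξ, charPair ξ v ∂σB)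
    (v : Fin r → ℤ) :
    μ.real B ^ 2 ≤ σB.real {ξ | charPair ξ v = 1} * μ.real (⋃ m : ℤ, T (m • v) '' B) := by
  set C : Set X := ⋃ m : ℤ, T (m • v) '' B with hC
  have hCm : MeasurableSet C := .iUnion fun m => by
    rw [image_eq_preimage_neg hzero hadd]
    exact (hmp _).measurable hB
  have hsub : ∀ n : ℕ, T (n • v) ⁻¹' B ⊆ C := fun n => by
    refine Set.subset_iUnion_of_subset (-(n : ℤ)) ?_
    rw [image_eq_preimage_neg hzero hadd]
    simp
  let u : Lp ℝ 2 μ := indicatorConstLp 2 hCm (measure_ne_top μ _) 1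
  have hu : ‖u‖ ^ 2 = μ.real C := by
    rw [← real_inner_self_eq_norm_sq, L2.inner_indicatorConstLp_indicatorConstLp]
    simp
  have hue : ∀ n : ℕ, inner ℝ u (translateIndicator hmp hB (n • v)) = μ.real B := fun n => by
    rw [translateIndicator, L2.inner_indicatorConstLp_indicatorConstLp,
      Set.inter_eq_self_of_subset_right (hsub n),
      measureReal_def, (hmp _).measure_preimage hB.nullMeasurableSet]
    simp [measureReal_def]
  refine ge_of_tendsto ((tendsto_integral_norm_average_charPair_sq σB v).mul_const _) ?_
  filter_upwards [eventually_ne_atTop 0] with N hN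
  have hnorm := norm_sum_sq_eq_integral_charPair (E := Lp ℝ 2 μ) (σ := σB)
    (e := translateIndicator hmp hB)
    (fun v w => by rw [inner_translateIndicator hmp hzero hadd, hσ])
    (Finset.range N) (fun _ => (N : ℝ)⁻¹) fun n => n • v
  push_cast at hnorm ⊢
  rw [← hnorm, ← hu, ← mul_pow, mul_comm]
  refine pow_le_pow_left₀ measureReal_nonneg (le_trans (le_of_eq ?_) (real_inner_le_norm _ _)) 2
  simp only [inner_sum, real_inner_smul_right, hue, Finset.sum_const, Finset.card_range]
  rw [nsmul_eq_mul]
  field_simp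

end Ergodic

/-- If `(X, μ)` is an ergodic p.m.p. `ℤ^r`-space, `B` has positive measure and its
spectral measure satisfies `σ_B(Rat ℤ^r \ {0}) < ε·μ(B)²`, then every haystack
`H ⊆ ℤ^r` contains some `λ` with `μ(⋃_{m ∈ ℤ} (mλ).B) > 1 − ε`. -/
theorem haystack_expansion
    {r : ℕ} {X : Type*} [MeasurableSpace X] (μ : Measure X) [IsProbabilityMeasure μ]
    (T : (Fin r → ℤ) → X → X)
    (hmp : ∀ v, MeasurePreserving (T v) μ μ)
    (hzero : ∀ x, T 0 x = x)
    (hadd : ∀ v w x, T (v + w) x = T v (T w x))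
    (herg : ∀ A : Set X, MeasurableSet A → (∀ v, T v ⁻¹' A = A) → μ A = 0 ∨ μ A = 1)
    (B : Set X) (hB : MeasurableSet B) (hBpos : 0 < μ B)
    (σB : Measure (Fin r → AddCircle (1 : ℝ))) [IsFiniteMeasure σB]
    (hσ : ∀ v : Fin r → ℤ, ((μ (B ∩ T v '' B)).toReal : ℂ) = ∫ ξ, charPair ξ v ∂σB)
    (ε : ℝ)
    (hrat : (σB {ξ | ξ ∈ ratSpectrum r ∧ ξ ≠ 0}).toReal < ε * (μ B).toReal ^ 2)
    (H : Set (Fin r → ℤ)) (hH : IsHaystack H) :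
    ∃ lam ∈ H, 1 - ε < (μ (⋃ m : ℤ, T (m • lam) '' B)).toReal := by
  have hb : 0 < μ.real B := ENNReal.toReal_pos hBpos.ne' (measure_ne_top μ B)
  rw [← measureReal_def, ← measureReal_def] at hrat
  obtain ⟨v, hvH, hv⟩ := hH.exists_measureReal_lt σB (sub_pos.mpr hrat)
  refine ⟨v, hvH, ?_⟩
  rw [← measureReal_def]
  have hε : 0 < ε := pos_of_mul_pos_left (measureReal_nonneg.trans_lt hrat) (sq_nonneg _)
  have hzero_le := spectralMeasure_zero_le hmp hzero hadd herg hB hσ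
  have hsat := measureReal_sq_le_mul_iUnion hmp hzero hadd hB hσ v
  set C := μ.real (⋃ m : ℤ, T (m • v) '' B) with hC
  have hcover : σB.real {ξ | charPair ξ v = 1} < (1 + ε) * μ.real B ^ 2 := by
    have hsub : {ξ | charPair ξ v = 1} ⊆ ({0} ∪ {ξ | ξ ∈ ratSpectrum r ∧ ξ ≠ 0}) ∪
        ({ξ | charPair ξ v = 1} \ ratSpectrum r) := by
      intro ξ hξ
      by_cases h0 : ξ = 0 <;> by_cases hr : ξ ∈ ratSpectrum r <;> simp_all
    have h1 := measureReal_mono (μ := σB) hsub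
    have h2 := measureReal_union_le (μ := σB) ({0} ∪ {ξ | ξ ∈ ratSpectrum r ∧ ξ ≠ 0})
      ({ξ | charPair ξ v = 1} \ ratSpectrum r)
    have h3 := measureReal_union_le (μ := σB) {0} {ξ | ξ ∈ ratSpectrum r ∧ ξ ≠ 0}
    linarith
  have hCnn : 0 ≤ C := measureReal_nonneg
  have hb2 : 0 < μ.real B ^ 2 := by positivity
  have hCpos : 0 < C := by
    refine hCnn.lt_of_ne fun h => ?_
    rw [← h, mul_zero] at hsat
    linarith
  have hlt : 1 < (1 + ε) * C := by
    have := hsat.trans_lt (mul_lt_mul_of_pos_right hcover hCpos)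
    nlinarith
  nlinarith
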